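/- Let (A,·,T) be a Rota-Baxter algebra of weight λ over a field k of characteristic 0 and (M,T_M) a Rota-Baxter bimodule over it. Set C⁰_RBA(A,M) := M and, for n ≥ 1, Cⁿ_RBA(A,M) := {k-multilinear maps A^n → M} ⊕ {k-multilinear maps A^{n−1} → M}, with differential d⁰(x) := (δ⁰(x), −x) and dⁿ(f,g) := (δⁿ(f), −∂^{n−1}(g) − Φⁿ(f)) for n ≥ 1. Then d is a differential: d^{n+1}∘dⁿ = 0 for all n ≥ 0, so (C•_RBA(A,M), d) is a cochain complex (the cochain complex of the Rota-Baxter algebra (A,·,T) with coefficients in (M,T_M)). -/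

import Mathlib

/-- The Hochschild coboundary `δⁿ` (0-indexed version); for `n = 0` it is
`δ⁰(x)(a) = −a x + x a`. -/
def hochschildCoboundary {A M : Type*} [NonUnitalRing A] [AddCommGroup M]
    (lsmul : A → M → M) (rsmul : M → A → M)
    (n : ℕ) (f : (Fin n → A) → M) : (Fin (n + 1) → A) → M := fun a =>
  ((-1 : ℤ) ^ (n + 1)) • lsmul (a 0) (f fun i => a i.succ)
    + (∑ i : Fin n, ((-1 : ℤ) ^ (n - (i : ℕ))) • f (fun j =>
        if (j : ℕ) < (i : ℕ) then a j.castSucc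
        else if (j : ℕ) = (i : ℕ) then a j.castSucc * a j.succ
        else a j.succ))
    + rsmul (f fun i => a i.castSucc) (a (Fin.last n))

/-- The coboundary `∂ⁿ` of the cochain complex of a Rota-Baxter operator (0-indexed
version). -/
def rboCoboundary {k A M : Type*} [Field k] [NonUnitalRing A] [Module k A]
    [AddCommGroup M] [Module k M]
    (lsmul : A → M → M) (rsmul : M → A → M) (T : A → A) (TM : M → M) (lam : k)
    (n : ℕ) (f : (Fin n → A) → M) : (Fin (n + 1) → A) → M := fun a =>
  ((-1 : ℤ) ^ (n + 1)) •
      (lsmul (T (a 0)) (f fun i => a i.succ) - TM (lsmul (a 0) (f fun i => a i.succ)))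
    + (∑ i : Fin n, ((-1 : ℤ) ^ (n - (i : ℕ))) •
        (f (fun j =>
            if (j : ℕ) < (i : ℕ) then a j.castSucc
            else if (j : ℕ) = (i : ℕ) then a j.castSucc * T (a j.succ)
            else a j.succ)
          + f (fun j =>
            if (j : ℕ) < (i : ℕ) then a j.castSucc
            else if (j : ℕ) = (i : ℕ) then T (a j.castSucc) * a j.succ
            else a j.succ)
          + lam • f (fun j =>
            if (j : ℕ) < (i : ℕ) then a j.castSucc
            else if (j : ℕ) = (i : ℕ) then a j.castSucc * a j.succ
            else a j.succ)))
    + (rsmul (f fun i => a i.castSucc) (T (a (Fin.last n)))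
        - TM (rsmul (f fun i => a i.castSucc) (a (Fin.last n))))

/-- The chain map `Φⁿ`, with `Φ⁰ = id`. -/
def PhiMap {k A M : Type*} [Field k] [NonUnitalRing A] [Module k A]
    [AddCommGroup M] [Module k M]
    (T : A → A) (TM : M → M) (lam : k)
    (n : ℕ) (f : (Fin n → A) → M) : (Fin n → A) → M := fun a =>
  f (fun j => T (a j))
    - ∑ c ∈ Finset.range n, (lam ^ (n - c - 1)) •
        ∑ S ∈ Finset.powersetCard c (Finset.univ : Finset (Fin n)),
          TM (f fun j => if j ∈ S then T (a j) else a j)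

/-- Multiply the adjacent entries `a i` and `a (i + 1)` of the tuple `a`. -/
def contractAt {A : Type*} (mul : A → A → A) {n : ℕ} (i : Fin n) (a : Fin (n + 1) → A) :
    Fin n → A := fun j =>
  if (j : ℕ) < (i : ℕ) then a j.castSucc
  else if (j : ℕ) = (i : ℕ) then mul (a j.castSucc) (a j.succ)
  else a j.succ

/-- The Hochschild coboundary for an arbitrary binary operation on `A`. -/
def barCoboundary {A M : Type*} [AddCommGroup M] (mul : A → A → A) (l r : A → M →+ M)
    (n : ℕ) (f : (Fin n → A) → M) : (Fin (n + 1) → A) → M := fun a =>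
  ((-1 : ℤ) ^ (n + 1)) • l (a 0) (f fun i => a i.succ)
    + (∑ i : Fin n, ((-1 : ℤ) ^ (n - (i : ℕ))) • f (contractAt mul i a))
    + r (a (Fin.last n)) (f fun i => a i.castSucc)

section Bar

universe u v

/-- The left action on functions `A → M` that implements dimension shifting. -/
def shiftLeftAction {A : Type u} {M : Type v} [AddCommGroup M] (mul : A → A → A)
    (l : A → M →+ M) (a : A) : (A → M) →+ (A → M) where
  toFun φ x := φ (mul x a) - l x (φ a)
  map_zero' := by ext; simp
  map_add' φ ψ := by ext; simp; abel

/-- The pointwise right action on functions `A → M`. -/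
def shiftRightAction {A : Type u} {M : Type v} [AddCommGroup M]
    (r : A → M →+ M) (a : A) : (A → M) →+ (A → M) where
  toFun φ x := r a (φ x)
  map_zero' := by ext; simp
  map_add' φ ψ := by ext; simp

theorem contractAt_zero_cons {A : Type*} (mul : A → A → A) {n : ℕ} (x : A)
    (a : Fin (n + 1) → A) :
    contractAt mul (0 : Fin (n + 1)) (Fin.cons x a : Fin (n + 2) → A)
      = Fin.cons (mul x (a 0)) (fun i => a i.succ) := by
  ext j
  refine Fin.cases ?_ (fun j => ?_) j <;> simp [contractAt]

theorem contractAt_succ_cons {A : Type*} (mul : A → A → A) {n : ℕ} (i : Fin n) (x : A)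
    (a : Fin (n + 1) → A) :
    contractAt mul i.succ (Fin.cons x a : Fin (n + 2) → A)
      = Fin.cons x (contractAt mul i a) := by
  ext j
  refine Fin.cases ?_ (fun j => ?_) j <;> simp [contractAt]

theorem cons_comp_castSucc {A : Type*} {n : ℕ} (x : A) (a : Fin (n + 1) → A) :
    (fun i : Fin (n + 1) => (Fin.cons x a : Fin (n + 2) → A) i.castSucc)
      = Fin.cons x (fun i => a i.castSucc) := by
  ext j
  refine Fin.cases ?_ (fun j => ?_) j <;> simp

theorem barCoboundary_cons {A : Type u} {M : Type v} [AddCommGroup M] (mul : A → A → A)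
    (l r : A → M →+ M) (n : ℕ) (f : (Fin (n + 1) → A) → M) (x : A) (a : Fin (n + 1) → A) :
    barCoboundary mul l r (n + 1) f (Fin.cons x a)
      = barCoboundary mul (shiftLeftAction mul l) (shiftRightAction r) n
          (fun b y => f (Fin.cons y b)) a x := by
  have ha : (Fin.cons (a 0) fun i => a (Fin.succ i) : Fin (n + 1) → A) = a :=
    Fin.cons_self_tail a
  simp only [barCoboundary, Fin.sum_univ_succ (n := n), contractAt_zero_cons,
    contractAt_succ_cons, cons_comp_castSucc, Pi.add_apply, Pi.smul_apply, Finset.sum_apply,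
    shiftLeftAction, shiftRightAction, AddMonoidHom.coe_mk, ZeroHom.coe_mk, Fin.cons_zero,
    Fin.cons_succ, Fin.val_zero, Fin.val_succ, Nat.sub_zero, Nat.add_sub_add_right,
    ← Fin.succ_last, ha, smul_sub, pow_succ (-1 : ℤ) (n + 1)]
  simp only [mul_neg, mul_one, neg_smul]
  abel

theorem barCoboundary_barCoboundary_of_max {A : Type u} (mul : A → A → A)
    (hmul : ∀ a b c, mul (mul a b) c = mul a (mul b c)) (n : ℕ) :
    ∀ {M : Type (max u v)} [AddCommGroup M] (l r : A → M →+ M)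
      (_ : ∀ a b m, l (mul a b) m = l a (l b m)) (_ : ∀ a b m, r (mul a b) m = r b (r a m))
      (_ : ∀ a b m, r b (l a m) = l a (r b m)) (f : (Fin n → A) → M),
      barCoboundary mul l r (n + 1) (barCoboundary mul l r n f) = 0 := by
  induction n with
  | zero =>
    intro M _ l r hl hr hlr f
    ext a
    have h : ∀ b : Fin 0 → A, f b = f Fin.elim0 := fun b => congrArg f (Subsingleton.elim _ _)
    simp [barCoboundary, contractAt, h, hl, hr, hlr]
    abel
  | succ n ih =>
    intro M _ l r hl hr hlr f
    ext a
    rw [← Fin.cons_self_tail a, barCoboundary_cons]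
    simp only [barCoboundary_cons]
    refine congrFun (congrFun (ih (M := A → M) _ _ ?_ ?_ ?_ _) _) _
    · intro a b φ
      ext x
      simp [shiftLeftAction, hmul, hl]
    · intro a b φ
      ext x
      simp [shiftRightAction, hr]
    · intro a b φ
      ext x
      simp [shiftLeftAction, shiftRightAction, hlr]

theorem barCoboundary_map {A M N : Type*} [AddCommGroup M] [AddCommGroup N] (mul : A → A → A)
    (l r : A → M →+ M) (l' r' : A → N →+ N) (e : M →+ N)
    (hl : ∀ a m, e (l a m) = l' a (e m)) (hr : ∀ a m, e (r a m) = r' a (e m))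
    (n : ℕ) (f : (Fin n → A) → M) (a : Fin (n + 1) → A) :
    e (barCoboundary mul l r n f a) = barCoboundary mul l' r' n (fun b => e (f b)) a := by
  simp [barCoboundary, hl, hr]

theorem barCoboundary_barCoboundary {A : Type u} {M : Type v} [AddCommGroup M]
    (mul : A → A → A) (hmul : ∀ a b c, mul (mul a b) c = mul a (mul b c)) (l r : A → M →+ M)
    (hl : ∀ a b m, l (mul a b) m = l a (l b m)) (hr : ∀ a b m, r (mul a b) m = r b (r a m))
    (hlr : ∀ a b m, r b (l a m) = l a (r b m)) (n : ℕ) (f : (Fin n → A) → M) :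
    barCoboundary mul l r (n + 1) (barCoboundary mul l r n f) = 0 := by
  let e : ULift.{u} M ≃+ M := AddEquiv.ulift
  let lift (s : A → M →+ M) (a : A) : ULift.{u} M →+ ULift.{u} M :=
    (e.symm.toAddMonoidHom.comp (s a)).comp e.toAddMonoidHom
  have h := barCoboundary_barCoboundary_of_max.{u, v} mul hmul n (lift l) (lift r)
    (by simp [lift, hl]) (by simp [lift, hr]) (by simp [lift, hlr]) (fun b => e.symm (f b))
  ext a
  have h' := congrArg e (congrFun h a)
  have key := fun n => barCoboundary_map mul (lift l) (lift r) l r e.toAddMonoidHom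
    (by simp [lift]) (by simp [lift]) n
  simp only [AddEquiv.coe_toAddMonoidHom] at key
  simpa [key] using h'

end Bar

/-- The tuple with entries `T (a j)` before position `p`, `a p` at position `p`, and
`U (a j)` after position `p`. -/
def pivot {A : Type*} (T U : A → A) {n : ℕ} (p : Fin n) (a : Fin n → A) : Fin n → A := fun j =>
  if (j : ℕ) < (p : ℕ) then T (a j) else if (j : ℕ) = (p : ℕ) then a j else U (a j)

theorem pivot_zero_cons {A : Type*} (T U : A → A) {n : ℕ} (x : A) (a : Fin n → A) :
    pivot T U (0 : Fin (n + 1)) (Fin.cons x a : Fin (n + 1) → A)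
      = Fin.cons x (fun j => U (a j)) := by
  ext j
  refine Fin.cases ?_ (fun j => ?_) j <;> simp [pivot]

theorem pivot_succ_cons {A : Type*} (T U : A → A) {n : ℕ} (p : Fin n) (x : A) (a : Fin n → A) :
    pivot T U p.succ (Fin.cons x a : Fin (n + 1) → A) = Fin.cons (T x) (pivot T U p a) := by
  ext j
  refine Fin.cases ?_ (fun j => ?_) j <;> simp [pivot]

theorem Finset.sum_univ_finset_fin_succ {M : Type*} [AddCommMonoid M] {n : ℕ}
    (G : Finset (Fin (n + 1)) → M) :
    ∑ S, G S = ∑ S : Finset (Fin n), G (S.map (Fin.succEmb n))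
      + ∑ S : Finset (Fin n), G (insert 0 (S.map (Fin.succEmb n))) := by
  have h : ∀ H : Finset (Fin (n + 1)) → M,
      ∑ S ∈ (Finset.univ.map (Fin.succEmb n)).powerset, H S
        = ∑ S : Finset (Fin n), H (S.map (Fin.succEmb n)) := fun H => by
    rw [← Finset.powerset_univ]
    symm
    refine Finset.sum_bij (fun S _ => S.map (Fin.succEmb n)) ?_ ?_ ?_ ?_
    · intro S _
      exact Finset.mem_powerset.2 (Finset.map_subset_map.2 (Finset.subset_univ S))
    · intro S _ S' _ hS
      exact Finset.map_injective _ hS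
    · intro S hS
      obtain ⟨u, -, rfl⟩ := Finset.subset_map_iff.1 (Finset.mem_powerset.1 hS)
      exact ⟨u, by simp, rfl⟩
    · simp
  rw [← Finset.powerset_univ, Fin.univ_succ, Finset.cons_eq_insert,
    Finset.sum_powerset_insert (by simp [Fin.succ_ne_zero])]
  exact congrArg₂ _ (h _) (h _)

theorem ite_mem_map_succ_cons {A : Type*} (T : A → A) {n : ℕ} (S : Finset (Fin n)) (x : A) (a : Fin n → A) :
    (fun j => if j ∈ S.map (Fin.succEmb n) then T ((Fin.cons x a : Fin (n + 1) → A) j)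
        else (Fin.cons x a : Fin (n + 1) → A) j)
      = Fin.cons x (fun j => if j ∈ S then T (a j) else a j) := by
  ext j
  refine Fin.cases ?_ (fun j => ?_) j <;> simp

theorem ite_mem_insert_map_succ_cons {A : Type*} (T : A → A) {n : ℕ} (S : Finset (Fin n)) (x : A)
    (a : Fin n → A) :
    (fun j => if j ∈ insert 0 (S.map (Fin.succEmb n))
        then T ((Fin.cons x a : Fin (n + 1) → A) j) else (Fin.cons x a : Fin (n + 1) → A) j)
      = Fin.cons (T x) (fun j => if j ∈ S then T (a j) else a j) := by
  ext j
  refine Fin.cases ?_ (fun j => ?_) j <;> simp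

section Pivot

variable {k A M : Type*} [Field k] [AddCommGroup A] [Module k A] [AddCommGroup M] [Module k M]

theorem MultilinearMap.map_cons_eq_curryLeft {n : ℕ}
    (f : MultilinearMap k (fun _ : Fin (n + 1) => A) M) (x : A) (a : Fin n → A) :
    f (Fin.cons x a) = f.curryLeft x a := rfl

theorem MultilinearMap.sum_subsets_eq (T : A → A) (lam : k) {n : ℕ}
    (f : MultilinearMap k (fun _ : Fin n => A) M) (a : Fin n → A) :
    ∑ S : Finset (Fin n), lam ^ (n - S.card) • f (fun j => if j ∈ S then T (a j) else a j)
      = f (fun j => T (a j) + lam • a j) := by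
  change _ = f ((fun j => T (a j)) + fun j => lam • a j)
  rw [MultilinearMap.map_add_univ]
  refine Finset.sum_congr rfl fun S _ => ?_
  have h := f.map_piecewise_smul (fun _ => lam) (fun j => if j ∈ S then T (a j) else a j) Sᶜ
  rw [Finset.prod_const, Finset.card_compl, Fintype.card_fin] at h
  rw [← h]
  congr 1
  ext j
  by_cases hj : j ∈ S <;> simp [Finset.piecewise, hj]

theorem MultilinearMap.sum_proper_subsets_eq_sum_pivot (T : A → A) (lam : k) {n : ℕ}
    (f : MultilinearMap k (fun _ : Fin n => A) M) (a : Fin n → A) :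
    (∑ S : Finset (Fin n), if S.card = n then 0 else
        lam ^ (n - S.card - 1) • f (fun j => if j ∈ S then T (a j) else a j))
      = ∑ p, f (pivot T (fun x => T x + lam • x) p a) := by
  induction n with
  | zero =>
    rw [Finset.univ_eq_empty (α := Fin 0), Finset.sum_empty]
    exact Finset.sum_eq_zero fun S _ => if_pos (by simp [S.eq_empty_of_isEmpty])
  | succ n ih =>
    obtain ⟨x, a, rfl⟩ : ∃ x b, a = Fin.cons x b := ⟨_, _, (Fin.cons_self_tail a).symm⟩
    rw [Finset.sum_univ_finset_fin_succ, Fin.sum_univ_succ, pivot_zero_cons]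
    simp only [pivot_succ_cons, ite_mem_map_succ_cons, ite_mem_insert_map_succ_cons,
      MultilinearMap.map_cons_eq_curryLeft]
    rw [← ih, ← MultilinearMap.sum_subsets_eq]
    congr 1 <;> refine Finset.sum_congr rfl fun S _ => ?_
    · have hS : S.card ≤ n := by simpa using S.card_le_univ
      rw [if_neg (by simp; omega), Finset.card_map]
      congr 2
      omega
    · rw [Finset.card_insert_of_notMem (by simp [Fin.succ_ne_zero]), Finset.card_map]
      simp

theorem MultilinearMap.sum_powersetCard_eq_sum_pivot (T : A → A) (lam : k) {n : ℕ}
    (f : MultilinearMap k (fun _ : Fin n => A) M) (a : Fin n → A) :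
    ∑ c ∈ Finset.range n, lam ^ (n - c - 1) •
        ∑ S ∈ Finset.powersetCard c (Finset.univ : Finset (Fin n)),
          f (fun j => if j ∈ S then T (a j) else a j)
      = ∑ p, f (pivot T (fun x => T x + lam • x) p a) := by
  rw [← MultilinearMap.sum_proper_subsets_eq_sum_pivot, ← Finset.powerset_univ,
    Finset.sum_powerset, Finset.card_univ, Fintype.card_fin, Finset.sum_range_succ,
    Finset.sum_eq_zero (s := Finset.powersetCard n _), add_zero]
  · refine Finset.sum_congr rfl fun c hc => ?_
    rw [Finset.smul_sum]
    refine Finset.sum_congr rfl fun S hS => ?_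
    rw [(Finset.mem_powersetCard.1 hS).2, if_neg (Finset.mem_range.1 hc).ne]
  · intro S hS
    rw [if_pos (Finset.mem_powersetCard.1 hS).2]

theorem MultilinearMap.smul_sum_pivot (T : A → A) (lam : k) {n : ℕ}
    (f : MultilinearMap k (fun _ : Fin n => A) M) (a : Fin n → A) :
    lam • ∑ p, f (pivot T (fun x => T x + lam • x) p a)
      = f (fun j => T (a j) + lam • a j) - f (fun j => T (a j)) := by
  induction n with
  | zero =>
    rw [Finset.univ_eq_empty, Finset.sum_empty, smul_zero, eq_comm, sub_eq_zero]
    exact congrArg f (Subsingleton.elim _ _)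
  | succ n ih =>
    obtain ⟨x, a, rfl⟩ : ∃ x b, a = Fin.cons x b := ⟨_, _, (Fin.cons_self_tail a).symm⟩
    have h : ∀ V : A → A, (fun j => V ((Fin.cons x a : Fin (n + 1) → A) j))
        = Fin.cons (V x) fun j => V (a j) := fun V => by
      ext j
      refine Fin.cases ?_ (fun j => ?_) j <;> simp
    rw [Fin.sum_univ_succ, pivot_zero_cons, h T, h fun y => T y + lam • y]
    simp only [pivot_succ_cons, MultilinearMap.map_cons_eq_curryLeft, smul_add, ih, map_add,
      map_smul, add_apply, smul_apply]
    abel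

end Pivot

/-- A function of `n` variables that is linear in each of them. -/
def IsMultilinear (k : Type*) {A M : Type*} [Field k] [AddCommGroup A] [Module k A]
    [AddCommGroup M] [Module k M] {n : ℕ} (F : (Fin n → A) → M) : Prop :=
  ∀ a p, IsLinearMap k fun x => F (Function.update a p x)

namespace IsMultilinear

variable {k A M : Type*} [Field k] [AddCommGroup A] [Module k A] [AddCommGroup M] [Module k M]
  {n m : ℕ}

theorem _root_.MultilinearMap.isMultilinear (f : MultilinearMap k (fun _ : Fin n => A) M) :
    IsMultilinear k f := fun a p => ⟨f.map_update_add a p, fun c x => f.map_update_smul a p c x⟩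

theorem exists_multilinearMap {F : (Fin n → A) → M} (hF : IsMultilinear k F) :
    ∃ f : MultilinearMap k (fun _ : Fin n => A) M, ⇑f = F :=
  ⟨MultilinearMap.mk' F (fun a p x y => (hF a p).map_add x y)
    (fun a p c x => (hF a p).map_smul c x), rfl⟩

theorem add {F G : (Fin n → A) → M} (hF : IsMultilinear k F) (hG : IsMultilinear k G) :
    IsMultilinear k fun a => F a + G a := fun a p =>
  ((hF a p).mk' _ + (hG a p).mk' _).isLinear

theorem sub {F G : (Fin n → A) → M} (hF : IsMultilinear k F) (hG : IsMultilinear k G) :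
    IsMultilinear k fun a => F a - G a := fun a p =>
  ((hF a p).mk' _ - (hG a p).mk' _).isLinear

theorem neg {F : (Fin n → A) → M} (hF : IsMultilinear k F) :
    IsMultilinear k fun a => - F a := fun a p => (-(hF a p).mk' _).isLinear

theorem zsmul {F : (Fin n → A) → M} (c : ℤ) (hF : IsMultilinear k F) :
    IsMultilinear k fun a => c • F a := fun a p => (c • (hF a p).mk' _).isLinear

theorem map {F : (Fin n → A) → M} (e : M →ₗ[k] M) (hF : IsMultilinear k F) :
    IsMultilinear k fun a => e (F a) := fun a p => (e ∘ₗ (hF a p).mk' _).isLinear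

theorem sum {ι : Type*} {s : Finset ι} {F : ι → (Fin n → A) → M}
    (hF : ∀ i, IsMultilinear k (F i)) : IsMultilinear k fun a => ∑ i ∈ s, F i a := fun a p => by
  convert (∑ i ∈ s, (hF i a p).mk' _).isLinear using 1
  ext x
  simp

theorem comp {F : (Fin n → A) → M} (hF : IsMultilinear k F) (h : (Fin m → A) → (Fin n → A))
    (hh : ∀ a p, ∃ q, ∃ φ : A →ₗ[k] A, ∀ x,
      h (Function.update a p x) = Function.update (h a) q (φ x)) :
    IsMultilinear k fun a => F (h a) := fun a p => by
  obtain ⟨q, φ, hφ⟩ := hh a p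
  simp only [hφ]
  exact ((hF (h a) q).mk' _ ∘ₗ φ).isLinear

theorem comp_linearMap {F : (Fin n → A) → M} (hF : IsMultilinear k F) (T : A →ₗ[k] A) :
    IsMultilinear k fun a => F fun j => T (a j) :=
  hF.comp _ fun a p => ⟨p, T, fun x => by
    ext j
    by_cases h : j = p <;> simp [h]⟩

theorem comp_pivot {F : (Fin n → A) → M} (hF : IsMultilinear k F) (T U : A →ₗ[k] A)
    (q : Fin n) : IsMultilinear k fun a => F (pivot T U q a) :=
  hF.comp _ fun a p => ⟨p, if (p : ℕ) < (q : ℕ) then T else if (p : ℕ) = (q : ℕ) then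
      LinearMap.id else U, fun x => by
    ext j
    by_cases h : j = p
    · subst h
      simp only [pivot, Function.update_self]
      split_ifs <;> rfl
    · simp [pivot, h]⟩

theorem comp_contractAt {F : (Fin n → A) → M} (hF : IsMultilinear k F)
    (mul : A →ₗ[k] A →ₗ[k] A) (i : Fin n) :
    IsMultilinear k fun a => F (contractAt (fun x y => mul x y) i a) := by
  refine hF.comp _ fun a p => ?_
  rcases lt_trichotomy (p : ℕ) i with h | h | h
  · refine ⟨⟨p, by omega⟩, LinearMap.id, fun x => ?_⟩
    ext j
    simp only [contractAt, Function.update_apply, Fin.ext_iff, Fin.val_castSucc, Fin.val_succ,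
      LinearMap.id_apply]
    split_ifs <;> first | rfl | omega
  · refine ⟨i, mul.flip (a i.succ), fun x => ?_⟩
    ext j
    simp only [contractAt, Function.update_apply, Fin.ext_iff, Fin.val_castSucc, Fin.val_succ,
      LinearMap.flip_apply]
    split_ifs <;> first | rfl | omega | skip
    obtain rfl : j = i := Fin.ext (by assumption)
    rfl
  · by_cases h' : (p : ℕ) = i + 1
    · refine ⟨i, mul (a i.castSucc), fun x => ?_⟩
      ext j
      simp only [contractAt, Function.update_apply, Fin.ext_iff, Fin.val_castSucc, Fin.val_succ]
      split_ifs <;> first | rfl | omega | skip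
      obtain rfl : j = i := Fin.ext (by assumption)
      rfl
    · refine ⟨⟨p - 1, by omega⟩, LinearMap.id, fun x => ?_⟩
      ext j
      simp only [contractAt, Function.update_apply, Fin.ext_iff, Fin.val_castSucc, Fin.val_succ,
        LinearMap.id_apply]
      split_ifs <;> first | rfl | omega

theorem head_tail {F : (Fin n → A) → M} (hF : IsMultilinear k F) (l : A →ₗ[k] M →ₗ[k] M) :
    IsMultilinear k fun a : Fin (n + 1) → A => l (a 0) (F fun i => a i.succ) := fun a p => by
  refine Fin.cases ?_ (fun p => ?_) p
  · convert (l.flip (F fun i => a i.succ)).isLinear using 1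
    ext x
    simp [Fin.succ_ne_zero]
  · convert (l (a 0) ∘ₗ (hF (fun i => a i.succ) p).mk' _).isLinear using 1
    ext x
    have h : (fun i : Fin n => Function.update a p.succ x i.succ)
        = Function.update (fun i => a i.succ) p x := by
      ext i
      simp [Function.update_apply]
    simp [h, (Fin.succ_ne_zero _).symm]

theorem last_init {F : (Fin n → A) → M} (hF : IsMultilinear k F) (r : A →ₗ[k] M →ₗ[k] M) :
    IsMultilinear k fun a : Fin (n + 1) → A =>
      r (a (Fin.last n)) (F fun i => a i.castSucc) := fun a p => by
  refine Fin.lastCases ?_ (fun p => ?_) p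
  · convert (r.flip (F fun i => a i.castSucc)).isLinear using 1
    ext x
    simp [Fin.castSucc_ne_last]
  · convert (r (a (Fin.last n)) ∘ₗ (hF (fun i => a i.castSucc) p).mk' _).isLinear using 1
    ext x
    have h : (fun i : Fin n => Function.update a p.castSucc x i.castSucc)
        = Function.update (fun i => a i.castSucc) p x := by
      ext i
      simp [Function.update_apply]
    simp [h, (Fin.castSucc_ne_last _).symm]

theorem coboundary {F : (Fin n → A) → M} (hF : IsMultilinear k F)
    (mul : A →ₗ[k] A →ₗ[k] A) (l r : A →ₗ[k] M →ₗ[k] M) :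
    IsMultilinear k (barCoboundary (fun x y => mul x y) (fun a => (l a).toAddMonoidHom)
      (fun a => (r a).toAddMonoidHom) n F) :=
  (((hF.head_tail l).zsmul _).add (sum fun i => (hF.comp_contractAt mul i).zsmul _)).add
    (hF.last_init r)

end IsMultilinear

theorem pivot_contractAt_apply_self {A : Type*} {n : ℕ} (T U : A → A) (mul : A → A → A) (i : Fin n)
    (a : Fin (n + 1) → A) :
    pivot T U i (contractAt mul i a) i = mul (a i.castSucc) (a i.succ) := by
  simp [pivot, contractAt]

section RotaBaxter

variable {k A M : Type*} [Field k] [NonUnitalRing A] [Module k A] [AddCommGroup M] [Module k M]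

/-- The left (or right) action of `A` on `M` induced by Rota-Baxter operators. -/
def inducedAction (T : A →ₗ[k] A) (TM : M →ₗ[k] M) (l : A →ₗ[k] M →ₗ[k] M) :
    A →ₗ[k] M →ₗ[k] M := l ∘ₗ T - l.compr₂ TM

theorem inducedAction_apply (T : A →ₗ[k] A) (TM : M →ₗ[k] M) (l : A →ₗ[k] M →ₗ[k] M)
    (a : A) (m : M) : inducedAction T TM l a m = l (T a) m - TM (l a m) := rfl

/-- `barCoboundary` for bilinear actions. -/
abbrev linBarCoboundary (mul : A →ₗ[k] A →ₗ[k] A) (l r : A →ₗ[k] M →ₗ[k] M) (n : ℕ)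
    (F : (Fin n → A) → M) : (Fin (n + 1) → A) → M :=
  barCoboundary (fun x y => mul x y) (fun a => (l a).toAddMonoidHom)
    (fun a => (r a).toAddMonoidHom) n F

theorem linBarCoboundary_neg_sub (mul : A →ₗ[k] A →ₗ[k] A) (l r : A →ₗ[k] M →ₗ[k] M) (n : ℕ)
    (F G : (Fin n → A) → M) (a : Fin (n + 1) → A) :
    linBarCoboundary mul l r n (fun x => - F x - G x) a
      = - linBarCoboundary mul l r n F a - linBarCoboundary mul l r n G a := by
  simp [barCoboundary, smul_sub]
  abel

theorem PhiMap_eq (T : A →ₗ[k] A) (TM : M →ₗ[k] M) (lam : k) {n : ℕ} {F : (Fin n → A) → M}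
    (hF : IsMultilinear k F) :
    PhiMap T TM lam n F = fun a => F (fun j => T (a j))
      - TM (∑ p, F (pivot T (T + lam • LinearMap.id : A →ₗ[k] A) p a)) := by
  obtain ⟨f, rfl⟩ := hF.exists_multilinearMap
  ext a
  have h := congrArg TM (f.sum_powersetCard_eq_sum_pivot T lam a)
  rw [map_sum] at h
  simp only [map_smul, map_sum] at h
  rw [map_sum]
  exact congrArg _ h

theorem PhiMap_isMultilinear (T : A →ₗ[k] A) (TM : M →ₗ[k] M) (lam : k) {n : ℕ}
    {F : (Fin n → A) → M} (hF : IsMultilinear k F) :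
    IsMultilinear k (PhiMap T TM lam n F) := by
  rw [PhiMap_eq T TM lam hF]
  exact (hF.comp_linearMap T).sub
    ((IsMultilinear.sum fun p => hF.comp_pivot T (T + lam • LinearMap.id) p).map TM)

/-- The contraction of pivoted tuples, away from the pivot. -/
theorem contractAt_pivot_succAbove {n : ℕ} (T U : A → A) (mul : A → A → A)
    (hT : ∀ a b, T (mul a b) = T a * T b) (hU : ∀ a b, U (mul a b) = U a * U b)
    (i q : Fin n) (hq : q ≠ i) (a : Fin (n + 1) → A) :
    contractAt (fun x y => x * y) i (pivot T U (i.castSucc.succAbove q) a)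
      = pivot T U q (contractAt mul i a) := by
  ext j
  rcases lt_or_gt_of_ne hq with h | h
  · rw [Fin.succAbove_of_castSucc_lt _ _ (Fin.castSucc_lt_castSucc_iff.2 h)]
    rw [Fin.lt_def] at h
    simp only [contractAt, pivot, Fin.val_castSucc, Fin.val_succ]
    split_ifs <;> first | rfl | omega | simp [hU]
  · rw [Fin.succAbove_of_le_castSucc _ _ (Fin.castSucc_le_castSucc_iff.2 h.le)]
    rw [Fin.lt_def] at h
    simp only [contractAt, pivot, Fin.val_castSucc, Fin.val_succ]
    split_ifs <;> first | rfl | omega | simp [hT]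

theorem contractAt_pivot_castSucc {n : ℕ} (T U : A → A) (mul : A → A → A) (i : Fin n)
    (a : Fin (n + 1) → A) :
    contractAt (fun x y => x * y) i (pivot T U i.castSucc a)
      = Function.update (pivot T U i (contractAt mul i a)) i (a i.castSucc * U (a i.succ)) := by
  ext j
  by_cases hj : j = i
  · subst hj
    simp [contractAt, pivot]
  · rw [Function.update_of_ne hj]
    have := Fin.val_ne_of_ne hj
    simp only [contractAt, pivot, Fin.val_castSucc, Fin.val_succ]
    split_ifs <;> first | rfl | omega

theorem contractAt_pivot_succ {n : ℕ} (T U : A → A) (mul : A → A → A) (i : Fin n)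
    (a : Fin (n + 1) → A) :
    contractAt (fun x y => x * y) i (pivot T U i.succ a)
      = Function.update (pivot T U i (contractAt mul i a)) i (T (a i.castSucc) * a i.succ) := by
  ext j
  by_cases hj : j = i
  · subst hj
    simp [contractAt, pivot]
  · rw [Function.update_of_ne hj]
    have := Fin.val_ne_of_ne hj
    simp only [contractAt, pivot, Fin.val_castSucc, Fin.val_succ]
    split_ifs <;> first | rfl | omega

theorem IsMultilinear.sum_contractAt_pivot {n : ℕ} {F : (Fin n → A) → M}
    (hF : IsMultilinear k F) (T U : A → A) (mul : A → A → A)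
    (hT : ∀ a b, T (mul a b) = T a * T b) (hU : ∀ a b, U (mul a b) = U a * U b)
    (hmul : ∀ a b, mul a b = a * U b + T a * b) (i : Fin n) (a : Fin (n + 1) → A) :
    ∑ p, F (contractAt (fun x y => x * y) i (pivot T U p a))
      = ∑ q, F (pivot T U q (contractAt mul i a)) := by
  rw [Fin.sum_univ_succAbove _ i.castSucc, ← Finset.add_sum_erase _ _ (Finset.mem_univ i),
    ← Finset.add_sum_erase _ (fun q => F (pivot T U q (contractAt mul i a))) (Finset.mem_univ i),
    ← add_assoc]
  congr 1
  · rw [Fin.succAbove_castSucc_self, contractAt_pivot_castSucc T U mul,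
      contractAt_pivot_succ T U mul,
      ← (hF _ i).map_add, ← hmul, ← pivot_contractAt_apply_self T U mul i a,
      Function.update_eq_self]
  · refine Finset.sum_congr rfl fun q hq => ?_
    rw [contractAt_pivot_succAbove T U mul hT hU i q (Finset.ne_of_mem_erase hq)]

variable [SMulCommClass k A A] [IsScalarTower k A A]

/-- The product `a * T b + T a * b + lam • (a * b)` induced by a Rota-Baxter operator. -/
def starMul (T : A →ₗ[k] A) (lam : k) : A →ₗ[k] A →ₗ[k] A :=
  (LinearMap.mul k A).compl₂ T + LinearMap.mul k A ∘ₗ T + lam • LinearMap.mul k A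

theorem starMul_apply (T : A →ₗ[k] A) (lam : k) (a b : A) :
    starMul T lam a b = a * T b + T a * b + lam • (a * b) := rfl

theorem hochschildCoboundary_eq (l r : A →ₗ[k] M →ₗ[k] M) (n : ℕ) (F : (Fin n → A) → M) :
    hochschildCoboundary (fun a m => l a m) (fun m a => r a m) n F
      = linBarCoboundary (LinearMap.mul k A) l r n F := rfl

theorem IsMultilinear.contractAt_starMul {n : ℕ} {F : (Fin n → A) → M}
    (hF : IsMultilinear k F) (T : A →ₗ[k] A) (lam : k) (i : Fin n) (a : Fin (n + 1) → A) :
    F (contractAt (fun x y => starMul T lam x y) i a)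
      = F (contractAt (fun x y => x * T y) i a) + F (contractAt (fun x y => T x * y) i a)
        + lam • F (contractAt (fun x y => x * y) i a) := by
  have h : ∀ mul : A → A → A, contractAt mul i a
      = Function.update (contractAt (fun x _ => x) i a) i (mul (a i.castSucc) (a i.succ)) := by
    intro mul
    ext j
    by_cases hj : j = i
    · subst hj
      simp [contractAt]
    · simp [contractAt, hj, Fin.val_ne_of_ne hj]
  rw [h, h fun x y => x * T y, h fun x y => T x * y, h fun x y => x * y, starMul_apply,
    (hF _ i).map_add, (hF _ i).map_add, (hF _ i).map_smul]

theorem rboCoboundary_eq (l r : A →ₗ[k] M →ₗ[k] M) (T : A →ₗ[k] A) (TM : M →ₗ[k] M) (lam : k)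
    {n : ℕ} {F : (Fin n → A) → M} (hF : IsMultilinear k F) :
    rboCoboundary (fun a m => l a m) (fun m a => r a m) T TM lam n F
      = linBarCoboundary (starMul T lam) (inducedAction T TM l) (inducedAction T TM r) n F := by
  ext a
  simp only [linBarCoboundary, barCoboundary, hF.contractAt_starMul]
  rfl

theorem IsMultilinear.sum_linBarCoboundary_pivot {n : ℕ} {F : (Fin n → A) → M}
    (hF : IsMultilinear k F) (l r : A →ₗ[k] M →ₗ[k] M) (T U : A → A) (mul : A → A → A)
    (hT : ∀ a b, T (mul a b) = T a * T b) (hU : ∀ a b, U (mul a b) = U a * U b)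
    (hmul : ∀ a b, mul a b = a * U b + T a * b) (a : Fin (n + 1) → A) :
    ∑ p, linBarCoboundary (LinearMap.mul k A) l r n F (pivot T U p a)
      = (-1 : ℤ) ^ (n + 1) • (l (a 0) (F fun i => U (a i.succ))
            + l (T (a 0)) (∑ q, F (pivot T U q fun i => a i.succ)))
        + (∑ i : Fin n, (-1 : ℤ) ^ (n - (i : ℕ)) • ∑ q, F (pivot T U q (contractAt mul i a)))
        + (r (U (a (Fin.last n))) (∑ q, F (pivot T U q fun i => a i.castSucc))
            + r (a (Fin.last n)) (F fun i => T (a i.castSucc))) := by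
  simp only [linBarCoboundary, barCoboundary, Finset.sum_add_distrib, LinearMap.mul_apply']
  congr 1
  · congr 1
    · rw [← Finset.smul_sum, Fin.sum_univ_succ, map_sum]
      have h : ∀ q : Fin n, (fun i : Fin n => pivot T U q.succ a i.succ)
          = pivot T U q fun i => a i.succ := fun q => by
        ext j
        simp [pivot]
      simp only [h]
      simp [pivot]
    · rw [Finset.sum_comm]
      refine Finset.sum_congr rfl fun i _ => ?_
      rw [← Finset.smul_sum, hF.sum_contractAt_pivot T U mul hT hU hmul]
  · rw [Fin.sum_univ_castSucc, map_sum]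
    congr 1
    · refine Finset.sum_congr rfl fun q _ => ?_
      have h : pivot T U q.castSucc a (Fin.last n) = U (a (Fin.last n)) := by
        simp [pivot, q.isLt.le.not_gt, q.isLt.ne']
      rw [h]
      rfl
    · simp [pivot]

/-- `PhiMap` intertwines the Hochschild coboundary with the coboundary of the induced
structure. -/
theorem linBarCoboundary_PhiMap (lam : k) (T : A →ₗ[k] A)
    (hT : ∀ a b : A, T a * T b = T (a * T b + T a * b + lam • (a * b)))
    (l r : A →ₗ[k] M →ₗ[k] M) (TM : M →ₗ[k] M)
    (hTM1 : ∀ (a : A) (m : M), l (T a) (TM m) = TM (l a (TM m) + l (T a) m + lam • l a m))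
    (hTM2 : ∀ (a : A) (m : M), r (T a) (TM m) = TM (r (T a) m + r a (TM m) + lam • r a m))
    {n : ℕ} {F : (Fin n → A) → M} (hF : IsMultilinear k F) :
    linBarCoboundary (starMul T lam) (inducedAction T TM l) (inducedAction T TM r) n
        (PhiMap T TM lam n F)
      = PhiMap T TM lam (n + 1) (linBarCoboundary (LinearMap.mul k A) l r n F) := by
  obtain ⟨f, rfl⟩ := hF.exists_multilinearMap
  have hTs : ∀ a b, T (starMul T lam a b) = T a * T b := fun a b => by
    rw [hT, starMul_apply]
  rw [PhiMap_eq T TM lam hF, PhiMap_eq T TM lam (hF.coboundary (LinearMap.mul k A) l r)]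
  ext a
  have key := congrArg TM (hF.sum_linBarCoboundary_pivot l r T
    (T + lam • LinearMap.id : A →ₗ[k] A) (fun x y => starMul T lam x y) hTs
    (fun a b => by
      simp only [LinearMap.add_apply, LinearMap.smul_apply, LinearMap.id_apply, hTs]
      simp only [starMul_apply, mul_add, add_mul, smul_add, smul_mul_assoc, mul_smul_comm]
      abel)
    (fun a b => by
      simp only [LinearMap.add_apply, LinearMap.smul_apply, LinearMap.id_apply]
      simp only [starMul_apply, mul_add, mul_smul_comm]
      abel) a)
  have hU : ∀ b : Fin n → A, f (fun j => (T + lam • LinearMap.id : A →ₗ[k] A) (b j))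
      = f (fun j => T (b j))
        + lam • ∑ p, f (pivot T (T + lam • LinearMap.id : A →ₗ[k] A) p b) := fun b =>
    (eq_add_of_sub_eq' (f.smul_sum_pivot T lam b).symm)
  have hc : ∀ i : Fin n, (fun j => T (contractAt (fun x y => starMul T lam x y) i a j))
      = contractAt (fun x y => x * y) i fun j => T (a j) := fun i => by
    ext j
    simp only [contractAt]
    split_ifs <;> simp [hTs]
  have hL : ∀ x m m', inducedAction T TM l x (m - TM m')
      = l (T x) m - TM (l x (m + lam • m') + l (T x) m') := fun x m m' => by
    simp only [inducedAction_apply, map_sub, map_add, map_smul, hTM1]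
    abel
  have hR : ∀ x m m', inducedAction T TM r x (m - TM m')
      = r (T x) m - TM (r (T x + lam • x) m' + r x m) := fun x m m' => by
    simp only [inducedAction_apply, map_sub, map_add, map_smul, hTM2, LinearMap.add_apply,
      LinearMap.smul_apply]
    abel
  rw [key]
  simp only [linBarCoboundary, barCoboundary, LinearMap.toAddMonoidHom_coe, hL, hR, hc, hU,
    smul_sub, Finset.sum_sub_distrib, LinearMap.mul_apply']
  simp only [map_add, map_zsmul, map_sum, map_smul, LinearMap.add_apply, LinearMap.smul_apply,
    LinearMap.id_apply, smul_add]
  abel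

theorem rboCoboundary_rboCoboundary (lam : k) (T : A →ₗ[k] A)
    (hT : ∀ a b : A, T a * T b = T (a * T b + T a * b + lam • (a * b)))
    (l r : A →ₗ[k] M →ₗ[k] M)
    (hl : ∀ (a b : A) (m : M), l (a * b) m = l a (l b m))
    (hr : ∀ (a b : A) (m : M), r (a * b) m = r b (r a m))
    (hlr : ∀ (a b : A) (m : M), r b (l a m) = l a (r b m))
    (TM : M →ₗ[k] M)
    (hTM1 : ∀ (a : A) (m : M), l (T a) (TM m) = TM (l a (TM m) + l (T a) m + lam • l a m))
    (hTM2 : ∀ (a : A) (m : M), r (T a) (TM m) = TM (r (T a) m + r a (TM m) + lam • r a m))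
    (n : ℕ) (F : (Fin n → A) → M) :
    linBarCoboundary (starMul T lam) (inducedAction T TM l) (inducedAction T TM r) (n + 1)
        (linBarCoboundary (starMul T lam) (inducedAction T TM l) (inducedAction T TM r) n F)
      = 0 := by
  have hTs : ∀ a b, T (starMul T lam a b) = T a * T b := fun a b => by
    rw [hT, starMul_apply]
  refine barCoboundary_barCoboundary _ ?_ _ _ ?_ ?_ ?_ n F
  · intro a b c
    rw [starMul_apply T lam (starMul T lam a b), starMul_apply T lam a (starMul T lam b c), hTs,
      hTs]
    simp only [starMul_apply, mul_add, add_mul, smul_add, smul_mul_assoc, mul_smul_comm,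
      mul_assoc]
    abel
  · intro a b m
    simp only [LinearMap.toAddMonoidHom_coe, inducedAction_apply, hTs, hl, map_sub, hTM1]
    simp only [starMul_apply, map_add, map_smul, LinearMap.add_apply, LinearMap.smul_apply, hl]
    abel
  · intro a b m
    simp only [LinearMap.toAddMonoidHom_coe, inducedAction_apply, hTs, hr, map_sub, hTM2]
    simp only [starMul_apply, map_add, map_smul, LinearMap.add_apply, LinearMap.smul_apply, hr]
    abel
  · intro a b m
    simp only [LinearMap.toAddMonoidHom_coe, inducedAction_apply, map_sub, hTM1, hTM2, hlr]
    simp only [map_add, map_smul]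
    abel

end RotaBaxter

/-- The differential `d` of the cochain complex of a Rota-Baxter algebra,
`d⁰(x) = (δ⁰(x), −x)` and `dⁿ(f, g) = (δⁿ(f), −∂^{n−1}(g) − Φⁿ(f))` for `n ≥ 1`,
squares to zero: `d^{n+1} ∘ dⁿ = 0` for all `n ≥ 0`.  Thus `(C•_RBA(A,M), d)` is a
cochain complex, the cochain complex of the Rota-Baxter algebra `(A, ·, T)` with
coefficients in `(M, T_M)`. -/
theorem rbaCoboundary_squared_eq_zero {k A M : Type*} [Field k] [CharZero k]
    [NonUnitalRing A] [Module k A] [SMulCommClass k A A] [IsScalarTower k A A]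
    [AddCommGroup M] [Module k M]
    (lam : k) (T : A →ₗ[k] A)
    (hT : ∀ a b : A, T a * T b = T (a * T b + T a * b + lam • (a * b)))
    (l r : A →ₗ[k] M →ₗ[k] M)
    (hl : ∀ (a b : A) (m : M), l (a * b) m = l a (l b m))
    (hr : ∀ (a b : A) (m : M), r (a * b) m = r b (r a m))
    (hlr : ∀ (a b : A) (m : M), r b (l a m) = l a (r b m))
    (TM : M →ₗ[k] M)
    (hTM1 : ∀ (a : A) (m : M), l (T a) (TM m) = TM (l a (TM m) + l (T a) m + lam • l a m))
    (hTM2 : ∀ (a : A) (m : M), r (T a) (TM m) = TM (r (T a) m + r a (TM m) + lam • r a m)) :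
    (∀ x : M,
      hochschildCoboundary (fun a m => l a m) (fun m a => r a m) 1
          (hochschildCoboundary (fun a m => l a m) (fun m a => r a m) 0
            (fun _ => x)) = 0 ∧
      (fun a : Fin 1 → A =>
          - rboCoboundary (fun a m => l a m) (fun m a => r a m) (⇑T) (⇑TM) lam 0
              (fun _ => -x) a
          - PhiMap (⇑T) (⇑TM) lam 1
              (hochschildCoboundary (fun a m => l a m) (fun m a => r a m) 0
                (fun _ => x)) a) = 0) ∧
    (∀ (n : ℕ) (f : MultilinearMap k (fun _ : Fin (n + 1) => A) M)
        (g : MultilinearMap k (fun _ : Fin n => A) M),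
      hochschildCoboundary (fun a m => l a m) (fun m a => r a m) (n + 2)
          (hochschildCoboundary (fun a m => l a m) (fun m a => r a m) (n + 1) ⇑f) = 0 ∧
      (fun a : Fin (n + 2) → A =>
          - rboCoboundary (fun a m => l a m) (fun m a => r a m) (⇑T) (⇑TM) lam (n + 1)
              (fun x : Fin (n + 1) → A =>
                - rboCoboundary (fun a m => l a m) (fun m a => r a m) (⇑T) (⇑TM) lam n
                    ⇑g x
                - PhiMap (⇑T) (⇑TM) lam (n + 1) ⇑f x) a
          - PhiMap (⇑T) (⇑TM) lam (n + 2)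
              (hochschildCoboundary (fun a m => l a m) (fun m a => r a m) (n + 1) ⇑f)
              a) = 0) := by
  have hδδ : ∀ (n : ℕ) (F : (Fin n → A) → M),
      hochschildCoboundary (fun a m => l a m) (fun m a => r a m) (n + 1)
        (hochschildCoboundary (fun a m => l a m) (fun m a => r a m) n F) = 0 := fun n F =>
    barCoboundary_barCoboundary (· * ·) mul_assoc (fun a => (l a).toAddMonoidHom)
      (fun a => (r a).toAddMonoidHom) hl hr hlr n F
  refine ⟨fun x => ⟨hδδ 0 _, ?_⟩, fun n f g => ⟨hδδ (n + 1) _, ?_⟩⟩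
  · ext a
    have hx : IsMultilinear k fun _ : Fin 0 → A => x := fun _ p => p.elim0
    have h := congrFun (linBarCoboundary_PhiMap lam T hT l r TM hTM1 hTM2 hx) a
    rw [hochschildCoboundary_eq, ← h, rboCoboundary_eq _ _ _ _ _ hx.neg]
    simp [linBarCoboundary, barCoboundary, PhiMap]
    abel
  · ext a
    have hf := f.isMultilinear
    have hg := g.isMultilinear
    have h := congrFun (linBarCoboundary_PhiMap lam T hT l r TM hTM1 hTM2 hf) a
    have h' := congrFun (rboCoboundary_rboCoboundary lam T hT l r hl hr hlr TM hTM1 hTM2 n g) a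
    have hb := hg.coboundary (starMul T lam) (inducedAction T TM l) (inducedAction T TM r)
    rw [hochschildCoboundary_eq, ← h, rboCoboundary_eq _ _ _ _ _ hg,
      rboCoboundary_eq _ _ _ _ _ (hb.neg.sub (PhiMap_isMultilinear T TM lam hf)),
      linBarCoboundary_neg_sub, h']
    simp
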